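/- With the same definitions of Z, ρ = 12, α² = 54 and q_{2k} = q_{2k+1} = Z(2k+2) ρ^{-1} α^{-2k}, the sum over even indices satisfies ∑_{k≥0} q_{2k} = 1/8. -/

import Mathlib

/-- `Z2 m` is the quantity `Z(2m)` from the paper: `Z(2) = 4/3` and
`Z(2m) = 8^m (3m-4)! / ((m-2)! (2m)!)` for `m ≥ 2`. -/
def Z2 (m : ℕ) : ℚ :=
  if m = 1 then 4/3
  else (8 : ℚ) ^ m * (Nat.factorial (3 * m - 4)) /
    ((Nat.factorial (m - 2)) * (Nat.factorial (2 * m)))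

/-- `q2 k` is `q_{2k} = q_{2k+1} = Z(2k+2) ρ^{-1} α^{-2k}` with `ρ = 12`, `α² = 54`. -/
def q2 (k : ℕ) : ℚ := Z2 (k + 1) / (12 * 54 ^ k)

open Filter Topology Finset

/-- The `m`-th term of the hypergeometric series `₂F₁(-1/3, -2/3; c; 1)`. -/
noncomputable def hypTerm (c : ℝ) : ℕ → ℝ
  | 0 => 1
  | m + 1 => hypTerm c m * ((m - 1 / 3) * (m - 2 / 3) / ((m + c) * (m + 1)))

lemma hypTerm_succ_bounds {c : ℝ} (hc : 1 / 2 ≤ c) (m : ℕ) :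
    0 ≤ hypTerm c (m + 1) ∧ hypTerm c (m + 1) ≤ 1 / c * (1 / ((m : ℝ) + 1) ^ 2) := by
  have hc0 : 0 < c := by linarith
  induction m with
  | zero =>
    have h : hypTerm c 1 = 2 / 9 * (1 / c) := by
      simp only [hypTerm]
      push_cast
      field_simp
      ring
    have hinv : 0 < 1 / c := by positivity
    rw [zero_add, h]
    constructor
    · positivity
    · rw [Nat.cast_zero, zero_add, one_pow, div_one, mul_one]
      linarith
  | succ m ih =>
    obtain ⟨h0, h1⟩ := ih
    have hm : (0 : ℝ) ≤ m := Nat.cast_nonneg m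
    have hr : (0 : ℝ) ≤ ((m + 1 : ℕ) - 1 / 3) * ((m + 1 : ℕ) - 2 / 3) /
        (((m + 1 : ℕ) + c) * ((m + 1 : ℕ) + 1)) := by
      push_cast
      apply div_nonneg
      · apply mul_nonneg <;> linarith
      · positivity
    rw [hypTerm]
    refine ⟨mul_nonneg h0 hr, (mul_le_mul_of_nonneg_right h1 hr).trans ?_⟩
    rw [mul_assoc]
    refine mul_le_mul_of_nonneg_left ?_ (by positivity)
    push_cast
    rw [div_mul_div_comm, div_le_div_iff₀ (by positivity) (by positivity)]
    have key : ((m : ℝ) + 1 - 1 / 3) * (m + 1 - 2 / 3) * (m + 1 + 1) ≤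
        (m + 1) ^ 2 * (m + 1 + c) := by
      nlinarith [mul_le_mul_of_nonneg_left hc (sq_nonneg ((m : ℝ) + 1)), pow_nonneg hm 2]
    have := mul_le_mul_of_nonneg_right key (by positivity : (0 : ℝ) ≤ m + 1 + 1)
    linarith

lemma summable_one_div_succ_sq : Summable fun m : ℕ => 1 / ((m : ℝ) + 1) ^ 2 := by
  simpa using (summable_nat_add_iff 1).mpr (Real.summable_one_div_nat_pow.mpr one_lt_two)

lemma summable_hypTerm {c : ℝ} (hc : 1 / 2 ≤ c) : Summable (hypTerm c) :=
  (summable_nat_add_iff 1).mp <| Summable.of_nonneg_of_le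
    (fun m => (hypTerm_succ_bounds hc m).1) (fun m => (hypTerm_succ_bounds hc m).2)
    (summable_one_div_succ_sq.mul_left _)

lemma tsum_hypTerm_eq {c : ℝ} (hc : 1 / 2 ≤ c) :
    ∑' m, hypTerm c m = 1 + ∑' m, hypTerm c (m + 1) :=
  (summable_hypTerm hc).tsum_eq_zero_add

lemma hypTerm_add_one {c : ℝ} (hc : 0 < c) (m : ℕ) :
    hypTerm (c + 1) m = hypTerm c m * (c / (c + m)) := by
  induction m with
  | zero => simp [hypTerm, hc.ne']
  | succ m ih =>
    rw [hypTerm, hypTerm, ih]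
    push_cast
    have : (0 : ℝ) ≤ m := Nat.cast_nonneg m
    field_simp
    ring

lemma tendsto_mul_hypTerm {c : ℝ} (hc : 1 / 2 ≤ c) :
    Tendsto (fun m : ℕ => (m : ℝ) * hypTerm c m) atTop (𝓝 0) := by
  rw [← tendsto_add_atTop_iff_nat 1]
  have hlim : Tendsto (fun m : ℕ => 1 / c * (1 / ((m : ℝ) + 1))) atTop (𝓝 0) := by
    simpa using tendsto_one_div_add_atTop_nhds_zero_nat.const_mul (1 / c)
  refine squeeze_zero (fun m => mul_nonneg (Nat.cast_nonneg _) (hypTerm_succ_bounds hc m).1)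
    (fun m => ?_) hlim
  refine (mul_le_mul_of_nonneg_left (hypTerm_succ_bounds hc m).2 (Nat.cast_nonneg _)).trans_eq ?_
  push_cast
  field_simp

lemma tsum_hypTerm_add_one {c : ℝ} (hc : 1 / 2 ≤ c) :
    ∑' m, hypTerm c m =
      (c + 1 / 3) * (c + 2 / 3) / (c * (c + 1)) * ∑' m, hypTerm (c + 1) m := by
  have hc0 : 0 < c := by linarith
  have hterm (m : ℕ) : (c + 1) * hypTerm c m -
      (c + 1 / 3) * (c + 2 / 3) / c * hypTerm (c + 1) m =
      -(((m + 1 : ℕ) : ℝ) * hypTerm c (m + 1) - (m : ℝ) * hypTerm c m) := by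
    rw [hypTerm_add_one hc0, hypTerm]
    push_cast
    have : (0 : ℝ) ≤ m := Nat.cast_nonneg m
    field_simp
    ring
  have hsum := ((summable_hypTerm hc).hasSum.mul_left (c + 1)).sub
    ((summable_hypTerm (c := c + 1) (by linarith)).hasSum.mul_left
      ((c + 1 / 3) * (c + 2 / 3) / c))
  have hzero := tendsto_nhds_unique hsum.tendsto_sum_nat (b := 0) <| by
    simp_rw [hterm, sum_neg_distrib, sum_range_sub fun m : ℕ => (m : ℝ) * hypTerm c m]
    simpa using (tendsto_mul_hypTerm hc).neg
  field_simp at hzero ⊢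
  linarith

lemma tendsto_tsum_hypTerm :
    Tendsto (fun n : ℕ => ∑' m, hypTerm (1 / 2 + n) m) atTop (𝓝 1) := by
  have hc (n : ℕ) : (1 / 2 : ℝ) ≤ 1 / 2 + n := le_add_of_nonneg_right (Nat.cast_nonneg n)
  have hinv : Tendsto (fun n : ℕ => 1 / (1 / 2 + (n : ℝ))) atTop (𝓝 0) := by
    simpa only [one_div, Function.comp_def] using tendsto_inv_atTop_zero.comp
      (tendsto_atTop_add_const_left _ (2⁻¹ : ℝ) tendsto_natCast_atTop_atTop)
  have hlim := (hinv.mul_const (∑' m : ℕ, 1 / ((m : ℝ) + 1) ^ 2)).const_add 1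
  rw [zero_mul, add_zero] at hlim
  refine tendsto_of_tendsto_of_tendsto_of_le_of_le tendsto_const_nhds hlim
    (fun n => ?_) (fun n => ?_)
  · dsimp only
    rw [tsum_hypTerm_eq (hc n)]
    exact le_add_of_nonneg_right (tsum_nonneg fun m => (hypTerm_succ_bounds (hc n) m).1)
  · dsimp only
    rw [tsum_hypTerm_eq (hc n), ← tsum_mul_left]
    gcongr
    · exact (summable_nat_add_iff 1).mpr (summable_hypTerm (hc n))
    · exact summable_one_div_succ_sq.mul_left _
    · exact (hypTerm_succ_bounds (hc n) _).2

lemma tsum_hypTerm_eq_prod (n : ℕ) :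
    ∑' m, hypTerm (1 / 2) m =
      (∏ j ∈ range n, ((5 / 6 + j) * (7 / 6 + j) / ((1 / 2 + j) * (3 / 2 + j)) : ℝ)) *
        ∑' m, hypTerm (1 / 2 + n) m := by
  induction n with
  | zero => simp
  | succ n ih =>
    rw [ih, prod_range_succ, tsum_hypTerm_add_one (le_add_of_nonneg_right (Nat.cast_nonneg n)),
      ← mul_assoc]
    push_cast
    ring_nf

lemma tendsto_prod_three_halves :
    Tendsto (fun n : ℕ => ∏ j ∈ range (n + 1),
      ((5 / 6 + j) * (7 / 6 + j) / ((1 / 2 + j) * (3 / 2 + j)) : ℝ)) atTop (𝓝 (3 / 2)) := by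
  have hhalf : Real.Gamma (1 / 2) * Real.Gamma (3 / 2) = Real.pi / 2 := by
    rw [show (3 / 2 : ℝ) = 1 / 2 + 1 by norm_num, Real.Gamma_add_one (by norm_num),
      Real.Gamma_one_half_eq]
    linear_combination Real.mul_self_sqrt Real.pi_pos.le / 2
  have hsixth : Real.Gamma (5 / 6) * Real.Gamma (7 / 6) = Real.pi / 3 := by
    have h := Real.Gamma_mul_Gamma_one_sub (1 / 6)
    rw [mul_one_div, Real.sin_pi_div_six, show (1 - 1 / 6 : ℝ) = 5 / 6 by norm_num] at h
    rw [show (7 / 6 : ℝ) = 1 / 6 + 1 by norm_num, Real.Gamma_add_one (by norm_num)]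
    linear_combination h / 6
  have hlim := ((Real.GammaSeq_tendsto_Gamma (1 / 2)).mul
    (Real.GammaSeq_tendsto_Gamma (3 / 2))).div
    ((Real.GammaSeq_tendsto_Gamma (5 / 6)).mul (Real.GammaSeq_tendsto_Gamma (7 / 6)))
    (by rw [hsixth]; positivity)
  rw [hhalf, hsixth, show Real.pi / 2 / (Real.pi / 3) = 3 / 2 by field_simp] at hlim
  refine hlim.congr' ?_
  filter_upwards [eventually_gt_atTop 0] with n hn
  have hn' : (0 : ℝ) < n := Nat.cast_pos.mpr hn
  have hpow : (n : ℝ) ^ (1 / 2 : ℝ) * (n : ℝ) ^ (3 / 2 : ℝ) =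
      (n : ℝ) ^ (5 / 6 : ℝ) * (n : ℝ) ^ (7 / 6 : ℝ) := by
    rw [← Real.rpow_add hn', ← Real.rpow_add hn']
    norm_num
  have hprod (s : ℝ) (hs : 0 < s) : ∏ j ∈ range (n + 1), (s + j) ≠ 0 :=
    (prod_pos fun j _ => add_pos_of_pos_of_nonneg hs (Nat.cast_nonneg j)).ne'
  have h₁ := hprod (1 / 2) (by norm_num)
  have h₂ := hprod (3 / 2) (by norm_num)
  have h₃ := hprod (5 / 6) (by norm_num)
  have h₄ := hprod (7 / 6) (by norm_num)
  have hfact : (n.factorial : ℝ) ≠ 0 := Nat.cast_ne_zero.mpr n.factorial_ne_zero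
  have h₅ := (Real.rpow_pos_of_pos hn' (5 / 6)).ne'
  have h₆ := (Real.rpow_pos_of_pos hn' (7 / 6)).ne'
  simp only [Pi.div_apply, Real.GammaSeq, prod_div_distrib, prod_mul_distrib]
  rw [div_mul_div_comm, div_mul_div_comm, mul_mul_mul_comm, hpow,
    mul_mul_mul_comm ((n : ℝ) ^ (5 / 6 : ℝ))]
  generalize (n : ℝ) ^ (5 / 6 : ℝ) = x at *
  generalize (n : ℝ) ^ (7 / 6 : ℝ) = y at *
  generalize ∏ j ∈ range (n + 1), ((1 / 2 : ℝ) + j) = p₁ at *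
  generalize ∏ j ∈ range (n + 1), ((3 / 2 : ℝ) + j) = p₂ at *
  generalize ∏ j ∈ range (n + 1), ((5 / 6 : ℝ) + j) = p₃ at *
  generalize ∏ j ∈ range (n + 1), ((7 / 6 : ℝ) + j) = p₄ at *
  field_simp

lemma tsum_hypTerm_half : ∑' m, hypTerm (1 / 2) m = 3 / 2 := by
  have hlim := tendsto_prod_three_halves.mul
    ((tendsto_add_atTop_iff_nat 1).mpr tendsto_tsum_hypTerm)
  simp_rw [← tsum_hypTerm_eq_prod, mul_one] at hlim
  exact tendsto_nhds_unique tendsto_const_nhds hlim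

lemma q2_succ (k : ℕ) :
    q2 (k + 1) = q2 k * (((k + 1 : ℕ) - 1 / 3) * ((k + 1 : ℕ) - 2 / 3) /
      (((k + 1 : ℕ) + 1 / 2) * ((k + 1 : ℕ) + 1))) := by
  rcases k with _ | k
  · norm_num [q2, Z2, Nat.factorial]
  · have e₁ : 3 * (k + 1 + 1 + 1) - 4 = 3 * k + 2 + 1 + 1 + 1 := by omega
    have e₂ : 3 * (k + 1 + 1) - 4 = 3 * k + 2 := by omega
    have e₃ : 2 * (k + 1 + 1 + 1) = 2 * k + 4 + 1 + 1 := by omega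
    have e₄ : 2 * (k + 1 + 1) = 2 * k + 4 := by omega
    have e₅ : k + 1 + 1 + 1 - 2 = k + 1 := by omega
    have e₆ : k + 1 + 1 - 2 = k := by omega
    have h₁ : k + 1 + 1 + 1 ≠ 1 := by omega
    have h₂ : k + 1 + 1 ≠ 1 := by omega
    simp only [q2, Z2, if_neg h₁, if_neg h₂, e₁, e₂, e₃, e₄, e₅, e₆]
    simp only [Nat.factorial_succ (3 * k + 2 + 1 + 1), Nat.factorial_succ (3 * k + 2 + 1),
      Nat.factorial_succ (3 * k + 2), Nat.factorial_succ (2 * k + 4 + 1),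
      Nat.factorial_succ (2 * k + 4), Nat.factorial_succ k]
    have f₁ : ((2 * k + 4).factorial : ℚ) ≠ 0 := Nat.cast_ne_zero.mpr (Nat.factorial_ne_zero _)
    have f₂ : (k.factorial : ℚ) ≠ 0 := Nat.cast_ne_zero.mpr (Nat.factorial_ne_zero _)
    push_cast
    generalize ((2 * k + 4).factorial : ℚ) = x at *
    generalize ((3 * k + 2).factorial : ℚ) = y at *
    generalize (k.factorial : ℚ) = z at *
    field_simp
    ring

lemma q2_eq_hypTerm (k : ℕ) : (q2 k : ℝ) = hypTerm (1 / 2) (k + 1) / 4 := by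
  induction k with
  | zero => norm_num [q2, Z2, hypTerm]
  | succ k ih =>
    rw [q2_succ, hypTerm, Rat.cast_mul, ih]
    push_cast
    ring

/-- The sum of the peeling probabilities over even indices:
`∑_{k≥0} q_{2k} = 1/8`. -/
theorem sum_q_even : ∑' k : ℕ, ((q2 k : ℝ)) = 1 / 8 := by
  simp_rw [q2_eq_hypTerm, tsum_div_const]
  linarith [tsum_hypTerm_half, tsum_hypTerm_eq (le_refl (1 / 2 : ℝ))]
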